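/- arXiv:1811.02502 — 2 statements merged into one kernel-verified Lean document; each statement's English description precedes it below -/
import Mathlib

section
/- If the initial array V^0 ∈ 𝒱 is nondecreasing and the k-th component of V^n = Φ^n(V^0) equals 1, then the l-th component of V^n equals 1 for every l > k. Symmetrically, if the k-th component of V^n equals −1, then the l-th component of V^n equals −1 for every l < k. -/
open Finset Filter

/-- `J ε V k` is the set of indices `l` whose opinions are `ε`-close to `V k`. -/
noncomputable def J {N : ℕ} (ε : ℝ) (V : Fin N → ℝ) (k : Fin N) : Finset (Fin N) :=
  Finset.univ.filter (fun l => |V l - V k| ≤ ε)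

/-- `w h ε V k = v_k + (h / I(v_k)) · Σ_{l ∈ J(v_k)} v_l`. -/
noncomputable def w {N : ℕ} (h ε : ℝ) (V : Fin N → ℝ) (k : Fin N) : ℝ :=
  V k + (h / (J ε V k).card) * ∑ l ∈ J ε V k, V l

/-- The opinion-dynamics operator `Φ`, obtained from `w` by cutting at `±1`. -/
noncomputable def Phi {N : ℕ} (h ε : ℝ) (V : Fin N → ℝ) : Fin N → ℝ :=
  fun k => max (-1) (min 1 (w h ε V k))

/-- The metric `ρ(V, V') = max_k |v_k − v'_k|` on `𝒱`. -/
noncomputable def rho {N : ℕ} (V V' : Fin N → ℝ) : ℝ := ⨆ k, |V k - V' k|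

theorem Finset.card_mul_sum_le_card_mul_sum {ι : Type*} (s t : Finset ι) (f : ι → ℝ)
    (hf : ∀ a ∈ s, ∀ b ∈ t, f a ≤ f b) :
    (t.card : ℝ) * ∑ a ∈ s, f a ≤ s.card * ∑ b ∈ t, f b := by
  have key : ∑ a ∈ s, ∑ _b ∈ t, f a ≤ ∑ _a ∈ s, ∑ b ∈ t, f b :=
    Finset.sum_le_sum fun a ha => Finset.sum_le_sum fun b hb => hf a ha b hb
  simpa [Finset.mul_sum] using key

theorem mem_J {N : ℕ} {ε : ℝ} {V : Fin N → ℝ} {k l : Fin N} :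
    l ∈ J ε V k ↔ |V l - V k| ≤ ε := by
  simp [J]

theorem card_J_pos {N : ℕ} {ε : ℝ} (hε : 0 ≤ ε) (V : Fin N → ℝ) (k : Fin N) :
    0 < (J ε V k).card :=
  Finset.card_pos.mpr ⟨k, mem_J.mpr (by simpa using hε)⟩

/-- The sum over the `ε`-neighbourhood, normalized by cardinality, is monotone in the opinion. -/
theorem card_J_mul_sum_le {N : ℕ} {ε : ℝ} {V : Fin N → ℝ} {k l : Fin N} (hkl : V k ≤ V l) :
    ((J ε V l).card : ℝ) * ∑ i ∈ J ε V k, V i ≤ (J ε V k).card * ∑ i ∈ J ε V l, V i := by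
  set A := J ε V k with hA
  set B := J ε V l with hB
  have below : ∀ a ∈ A \ B, ∀ b ∈ B, V a ≤ V b := by
    intro a ha b hb
    simp only [hA, hB, Finset.mem_sdiff, mem_J, abs_le, not_and_or, not_le] at ha hb
    rcases ha with ⟨⟨_, _⟩, h | h⟩ <;> linarith [hb.1]
  have above : ∀ a ∈ A, ∀ b ∈ B \ A, V a ≤ V b := by
    intro a ha b hb
    simp only [hA, hB, Finset.mem_sdiff, mem_J, abs_le, not_and_or, not_le] at ha hb
    rcases hb with ⟨⟨_, _⟩, h | h⟩ <;> linarith [ha.2]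
  have h₁ := Finset.card_mul_sum_le_card_mul_sum (A \ B) B V below
  have h₂ := Finset.card_mul_sum_le_card_mul_sum (A ∩ B) (B \ A) V
    fun a ha b hb => above a (Finset.mem_inter.mp ha).1 b hb
  have cA : ((A ∩ B).card : ℝ) + (A \ B).card = A.card := by
    exact_mod_cast Finset.card_inter_add_card_sdiff A B
  have cB : ((A ∩ B).card : ℝ) + (B \ A).card = B.card := by
    rw [Finset.inter_comm]
    exact_mod_cast Finset.card_inter_add_card_sdiff B A
  have sA : ∑ i ∈ A ∩ B, V i + ∑ i ∈ A \ B, V i = ∑ i ∈ A, V i :=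
    Finset.sum_inter_add_sum_sdiff A B V
  have sB : ∑ i ∈ A ∩ B, V i + ∑ i ∈ B \ A, V i = ∑ i ∈ B, V i := by
    rw [Finset.inter_comm]
    exact Finset.sum_inter_add_sum_sdiff B A V
  rw [← cB, ← sB] at h₁
  rw [← cA, ← cB, ← sA, ← sB]
  linarith

theorem w_le_w {N : ℕ} {h ε : ℝ} (hh : 0 ≤ h) (hε : 0 ≤ ε) {V : Fin N → ℝ} {k l : Fin N}
    (hkl : V k ≤ V l) : w h ε V k ≤ w h ε V l := by
  have hk : (0 : ℝ) < (J ε V k).card := by exact_mod_cast card_J_pos hε V k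
  have hl : (0 : ℝ) < (J ε V l).card := by exact_mod_cast card_J_pos hε V l
  have avg : (∑ i ∈ J ε V k, V i) / (J ε V k).card ≤ (∑ i ∈ J ε V l, V i) / (J ε V l).card := by
    rw [div_le_div_iff₀ hk hl]
    linarith [card_J_mul_sum_le (ε := ε) hkl]
  unfold w
  rw [div_mul_eq_mul_div, div_mul_eq_mul_div, mul_div_assoc, mul_div_assoc]
  exact add_le_add hkl (mul_le_mul_of_nonneg_left avg hh)

theorem Phi_monotone {N : ℕ} {h ε : ℝ} (hh : 0 ≤ h) (hε : 0 ≤ ε) {V : Fin N → ℝ}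
    (hV : Monotone V) : Monotone (Phi h ε V) := fun _ _ hkl =>
  max_le_max le_rfl (min_le_min le_rfl (w_le_w hh hε (hV hkl)))

theorem Phi_mem_Icc {N : ℕ} (h ε : ℝ) (V : Fin N → ℝ) (k : Fin N) :
    Phi h ε V k ∈ Set.Icc (-1 : ℝ) 1 :=
  ⟨le_max_left _ _, max_le (by norm_num) (min_le_left _ _)⟩

/-- if `V⁰` is nondecreasing and the `k`-th component of
`Vⁿ = Φⁿ(V⁰)` equals `1`, then the `l`-th component equals `1` for every
`l > k`; symmetrically, if the `k`-th component equals `−1`, then the `l`-th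
component equals `−1` for every `l < k`. -/
theorem statement3 (N : ℕ) (hN : 1 ≤ N) (h ε : ℝ)
    (hh : h ∈ Set.Ioo (0 : ℝ) 1) (hε : ε ∈ Set.Ioo (0 : ℝ) 1)
    (V0 : Fin N → ℝ) (hV0 : ∀ k, V0 k ∈ Set.Icc (-1 : ℝ) 1) (hmono : Monotone V0)
    (n : ℕ) :
    (∀ k l : Fin N, ((Phi h ε)^[n] V0) k = 1 → k < l → ((Phi h ε)^[n] V0) l = 1) ∧
      (∀ k l : Fin N, ((Phi h ε)^[n] V0) k = -1 → l < k → ((Phi h ε)^[n] V0) l = -1) := by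
  have inv : Monotone ((Phi h ε)^[n] V0) ∧ ∀ k, ((Phi h ε)^[n] V0) k ∈ Set.Icc (-1 : ℝ) 1 := by
    induction n with
    | zero => exact ⟨hmono, hV0⟩
    | succ n ih =>
      rw [Function.iterate_succ_apply']
      exact ⟨Phi_monotone hh.1.le hε.1.le ih.1, Phi_mem_Icc h ε _⟩
  exact ⟨fun k l hk hkl => le_antisymm (inv.2 l).2 (hk ▸ inv.1 hkl.le),
    fun k l hk hlk => le_antisymm (hk ▸ inv.1 hlk.le) (inv.2 l).1⟩
end

section
/- Let P ∈ 𝒱 be a nondecreasing fixed point of Φ that is not basic, i.e., Φ(P) = P and the set A = {k : |p_k| < 1} is nonempty. Then: (i) −ε < p_k < ε for every k ∈ A; (ii) J(P,k) = A for every k ∈ A; and (iii) Σ_{k ∈ A} p_k = 0. (Equivalently, P has the form (−1,…,−1, p_a,…,p_m, 1,…,1) where the middle block consists of the entries with modulus strictly less than ε, all entries of the middle block influence exactly the middle block, and the middle block sums to zero.) -/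
open Finset Filter

section FixedPoint

variable {N : ℕ} {h ε : ℝ} {P : Fin N → ℝ} {k l : Fin N}

lemma mem_J_iff : l ∈ J ε P k ↔ P k - ε ≤ P l ∧ P l ≤ P k + ε := by
  simp only [J, Finset.mem_filter, Finset.mem_univ, true_and, abs_le]
  constructor <;> rintro ⟨h₁, h₂⟩ <;> constructor <;> linarith

lemma self_mem_J (hε : 0 ≤ ε) : k ∈ J ε P k := by
  simp [J, hε]

/-- A fixed point has zero influence sum at every entry in the open interval `(-1, 1)`. -/
lemma sum_J_eq_zero_of_fixed (hh : 0 < h) (hε : 0 ≤ ε) (hfix : Phi h ε P = P)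
    (hk : |P k| < 1) : ∑ l ∈ J ε P k, P l = 0 := by
  obtain ⟨hk₁, hk₂⟩ := abs_lt.mp hk
  have hw : w h ε P k = P k := by
    have := congrFun hfix k
    simp only [Phi] at this
    grind
  have hcard : 0 < ((J ε P k).card : ℝ) := by
    exact_mod_cast Finset.card_pos.mpr ⟨k, self_mem_J hε⟩
  have hmul : h / (J ε P k).card * ∑ l ∈ J ε P k, P l = 0 := by
    simpa [w] using hw
  exact (mul_eq_zero.mp hmul).resolve_left (div_pos hh hcard).ne'

lemma lt_of_sum_J_eq_zero (hε : 0 < ε) (hsum : ∑ l ∈ J ε P k, P l = 0) : P k < ε := by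
  by_contra! hk
  have hnonneg : ∀ l ∈ J ε P k, 0 ≤ P l := fun l hl => by
    linarith [(mem_J_iff.mp hl).1]
  linarith [(Finset.sum_eq_zero_iff_of_nonneg hnonneg).mp hsum k (self_mem_J hε.le)]

lemma neg_lt_of_sum_J_eq_zero (hε : 0 < ε) (hsum : ∑ l ∈ J ε P k, P l = 0) : -ε < P k := by
  by_contra! hk
  have hnonpos : ∀ l ∈ J ε P k, P l ≤ 0 := fun l hl => by
    linarith [(mem_J_iff.mp hl).2]
  linarith [(Finset.sum_eq_zero_iff_of_nonpos hnonpos).mp hsum k (self_mem_J hε.le)]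

lemma J_eq_of_le_of_sum_eq_zero (hε : 0 < ε) (hkl : P k ≤ P l)
    (hk : ∑ i ∈ J ε P k, P i = 0) (hl : ∑ i ∈ J ε P l, P i = 0) : J ε P k = J ε P l := by
  have hk_lower := neg_lt_of_sum_J_eq_zero hε hk
  have hl_upper := lt_of_sum_J_eq_zero hε hl
  have hsum : ∑ i, ((if i ∈ J ε P l then P i else 0) - (if i ∈ J ε P k then P i else 0)) = 0 := by
    simp [Finset.sum_sub_distrib, hk, hl]
  have hnonneg : ∀ i ∈ Finset.univ,
      0 ≤ (if i ∈ J ε P l then P i else 0) - (if i ∈ J ε P k then P i else 0) := by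
    intro i _
    simp only [mem_J_iff]
    grind
  ext i
  have hi := (Finset.sum_eq_zero_iff_of_nonneg hnonneg).mp hsum i (Finset.mem_univ i)
  simp only [mem_J_iff] at hi ⊢
  grind

lemma J_eq_of_sum_eq_zero (hε : 0 < ε)
    (hk : ∑ i ∈ J ε P k, P i = 0) (hl : ∑ i ∈ J ε P l, P i = 0) : J ε P k = J ε P l := by
  rcases le_total (P k) (P l) with hkl | hlk
  · exact J_eq_of_le_of_sum_eq_zero hε hkl hk hl
  · exact (J_eq_of_le_of_sum_eq_zero hε hlk hl hk).symm

end FixedPoint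

/-- Theorem 2: let `P ∈ 𝒱` be a nondecreasing fixed point of
`Φ` that is not basic, i.e. the set `A = {k : |p_k| < 1}` is nonempty. Then
(i) `−ε < p_k < ε` for every `k ∈ A`; (ii) `J(P,k) = A` for every `k ∈ A`;
(iii) `Σ_{k ∈ A} p_k = 0`. -/
theorem statement10 (N : ℕ) (hN : 1 ≤ N) (h ε : ℝ)
    (hh : h ∈ Set.Ioo (0 : ℝ) 1) (hε : ε ∈ Set.Ioo (0 : ℝ) 1)
    (P : Fin N → ℝ) (hP : ∀ k, P k ∈ Set.Icc (-1 : ℝ) 1) (hmono : Monotone P)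
    (hfix : Phi h ε P = P)
    (A : Finset (Fin N)) (hA : A = Finset.univ.filter (fun k => |P k| < 1))
    (hne : A.Nonempty) :
    (∀ k ∈ A, -ε < P k ∧ P k < ε) ∧
      (∀ k ∈ A, J ε P k = A) ∧
      ∑ k ∈ A, P k = 0 := by
  obtain ⟨hε₀, hε₁⟩ := hε
  have hmem : ∀ k, k ∈ A ↔ |P k| < 1 := fun k => by simp [hA]
  have hsum : ∀ k ∈ A, ∑ l ∈ J ε P k, P l = 0 := fun k hk =>
    sum_J_eq_zero_of_fixed hh.1 hε₀.le hfix ((hmem k).mp hk)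
  have hbound : ∀ k ∈ A, -ε < P k ∧ P k < ε := fun k hk =>
    ⟨neg_lt_of_sum_J_eq_zero hε₀ (hsum k hk), lt_of_sum_J_eq_zero hε₀ (hsum k hk)⟩
  have hsub : ∀ k ∈ A, A ⊆ J ε P k := fun k hk l hl => by
    rw [J_eq_of_sum_eq_zero hε₀ (hsum k hk) (hsum l hl)]
    exact self_mem_J hε₀.le
  have hJ : ∀ k ∈ A, J ε P k = A := by
    intro k hk
    refine Finset.Subset.antisymm (fun l hl => ?_) (hsub k hk)
    by_contra hlA
    have hclose : ∀ j ∈ A, P j - ε ≤ P l ∧ P l ≤ P j + ε := fun j hj => by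
      rw [← mem_J_iff, J_eq_of_sum_eq_zero hε₀ (hsum j hj) (hsum k hk)]
      exact hl
    have hextreme : ∀ i, i ∉ A → P i = -1 ∨ P i = 1 := fun i hi => by
      have := hP i
      rw [hmem, abs_lt] at hi
      grind
    rcases hextreme l hlA with hPl | hPl
    · have hnonpos : ∀ i ∈ J ε P k, P i ≤ 0 := fun i hi => by
        by_cases hiA : i ∈ A
        · linarith [(hclose i hiA).1]
        · rcases hextreme i hiA with hPi | hPi
          · linarith
          · linarith [(mem_J_iff.mp hi).2, (hclose k hk).1]
      linarith [(Finset.sum_eq_zero_iff_of_nonpos hnonpos).mp (hsum k hk) l hl]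
    · have hnonneg : ∀ i ∈ J ε P k, 0 ≤ P i := fun i hi => by
        by_cases hiA : i ∈ A
        · linarith [(hclose i hiA).2]
        · rcases hextreme i hiA with hPi | hPi
          · linarith [(mem_J_iff.mp hi).1, (hclose k hk).2]
          · linarith
      linarith [(Finset.sum_eq_zero_iff_of_nonneg hnonneg).mp (hsum k hk) l hl]
  refine ⟨hbound, hJ, ?_⟩
  obtain ⟨k, hk⟩ := hne
  rw [← hJ k hk]
  exact hsum k hk
end
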